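/- Let G be a connected vertex-transitive graph (for every pair of vertices u, w there is a graph automorphism of G mapping u to w) and let z ∈ V(G). If the real number θ is a root of μ(G\z, x), then G is θ-super positive. -/

import Mathlib

open Polynomial

namespace MatchPoly

variable {V : Type*}

/-- The number of `r`-matchings in `G`: sets of `r` edges, no two sharing a vertex. -/
noncomputable def numMatchings (G : SimpleGraph V) (r : ℕ) : ℕ :=
  Nat.card {M : Finset (Sym2 V) // M.card = r ∧ (M : Set (Sym2 V)) ⊆ G.edgeSet ∧
    (M : Set (Sym2 V)).Pairwise fun e f => ∀ v : V, v ∈ e → v ∉ f}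

/-- The matching polynomial `μ(G,x) = ∑ (-1)^r p(G,r) x^(n-2r)`. -/
noncomputable def matchingPoly (G : SimpleGraph V) : Polynomial ℝ :=
  ∑ r ∈ Finset.range (Nat.card V + 1),
    Polynomial.C ((-1 : ℝ) ^ r * (numMatchings G r : ℝ)) *
      (Polynomial.X : Polynomial ℝ) ^ (Nat.card V - 2 * r)

/-- `mult θ G`: the multiplicity of `θ` as a root of `μ(G,x)`. -/
noncomputable def mult (θ : ℝ) (G : SimpleGraph V) : ℕ :=
  (matchingPoly G).rootMultiplicity θ

/-- `G \ X`: the induced subgraph on the complement of the vertex set `X`. -/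
def deleteSet (G : SimpleGraph V) (X : Set V) : SimpleGraph ↥(Xᶜ) :=
  G.induce (Xᶜ)

/-- `G \ v`: delete a single vertex. -/
def deleteVert (G : SimpleGraph V) (v : V) : SimpleGraph ↥({v}ᶜ : Set V) :=
  G.induce ({v}ᶜ : Set V)

/-- `u` is θ-essential: `mult(θ, G\u) = mult(θ,G) - 1`. -/
def IsEssential (θ : ℝ) (G : SimpleGraph V) (u : V) : Prop :=
  mult θ (deleteVert G u) + 1 = mult θ G

/-- `u` is θ-neutral: `mult(θ, G\u) = mult(θ,G)`. -/
def IsNeutral (θ : ℝ) (G : SimpleGraph V) (u : V) : Prop :=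
  mult θ (deleteVert G u) = mult θ G

/-- `u` is θ-positive: `mult(θ, G\u) = mult(θ,G) + 1`. -/
def IsPositive (θ : ℝ) (G : SimpleGraph V) (u : V) : Prop :=
  mult θ (deleteVert G u) = mult θ G + 1

/-- `u` is θ-special: not θ-essential but adjacent to a θ-essential vertex. -/
def IsSpecial (θ : ℝ) (G : SimpleGraph V) (u : V) : Prop :=
  ¬ IsEssential θ G u ∧ ∃ w : V, G.Adj u w ∧ IsEssential θ G w

/-- `A_θ(G)`: the set of θ-special vertices. -/
def specialSet (θ : ℝ) (G : SimpleGraph V) : Set V := {u | IsSpecial θ G u}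

/-- `N_θ(G)`: the set of θ-neutral vertices. -/
def neutralSet (θ : ℝ) (G : SimpleGraph V) : Set V := {u | IsNeutral θ G u}

/-- `P_θ(G)`: the set of θ-positive vertices that are not θ-special. -/
def positiveSet (θ : ℝ) (G : SimpleGraph V) : Set V :=
  {u | IsPositive θ G u ∧ ¬ IsSpecial θ G u}

/-- `G` is θ-super positive: `mult(θ,G) = 0` and `mult(θ,G\v) = 1` for every vertex `v`. -/
def IsSuperPositive (θ : ℝ) (G : SimpleGraph V) : Prop :=
  mult θ G = 0 ∧ ∀ v : V, mult θ (deleteVert G v) = 1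

/-- `G` is θ-elementary: θ-super positive and `P_θ(G\v) = ∅` for every vertex `v`. -/
def IsElementary (θ : ℝ) (G : SimpleGraph V) : Prop :=
  IsSuperPositive θ G ∧ ∀ v : V, positiveSet θ (deleteVert G v) = ∅

/-- `G` is θ-critical: every vertex is θ-essential and `mult(θ,G) = 1`. -/
def IsCritical (θ : ℝ) (G : SimpleGraph V) : Prop :=
  (∀ v : V, IsEssential θ G v) ∧ mult θ G = 1

/-- `c_θ(G)`: the number of θ-critical connected components of `G`. -/
noncomputable def numCritComponents (θ : ℝ) (G : SimpleGraph V) : ℕ :=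
  Nat.card {c : G.ConnectedComponent // IsCritical θ (G.induce c.supp)}

/-- `X` is a θ-barrier set: `mult(θ,G) = c_θ(G\X) - |X|`. -/
def IsBarrier (θ : ℝ) (G : SimpleGraph V) (X : Set V) : Prop :=
  numCritComponents θ (deleteSet G X) = mult θ G + X.ncard

/-- `X` is a θ-extreme set: `mult(θ,G\X) = mult(θ,G) + |X|`. -/
def IsExtreme (θ : ℝ) (G : SimpleGraph V) (X : Set V) : Prop :=
  mult θ (deleteSet G X) = mult θ G + X.ncard

/-- `G` is θ-base: θ-super positive and no θ-barrier set contains two adjacent vertices. -/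
def IsBase (θ : ℝ) (G : SimpleGraph V) : Prop :=
  IsSuperPositive θ G ∧
    ∀ X : Set V, IsBarrier θ G X → ∀ u v : V, u ∈ X → v ∈ X → ¬ G.Adj u v

section Divisibility

/-- Pointwise nonnegativity of a real polynomial. -/
def EvalNonneg (p : ℝ[X]) : Prop := ∀ x : ℝ, 0 ≤ p.eval x

theorem EvalNonneg.add {p q : ℝ[X]} (hp : EvalNonneg p) (hq : EvalNonneg q) :
    EvalNonneg (p + q) := fun x => by
  rw [eval_add]; exact add_nonneg (hp x) (hq x)

theorem EvalNonneg.mul {p q : ℝ[X]} (hp : EvalNonneg p) (hq : EvalNonneg q) :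
    EvalNonneg (p * q) := fun x => by
  rw [eval_mul]; exact mul_nonneg (hp x) (hq x)

theorem EvalNonneg.sum {ι : Type*} {s : Finset ι} {f : ι → ℝ[X]}
    (h : ∀ i ∈ s, EvalNonneg (f i)) : EvalNonneg (∑ i ∈ s, f i) := fun x => by
  rw [eval_finsetSum]; exact Finset.sum_nonneg fun i hi => h i hi x

theorem evalNonneg_sq (p : ℝ[X]) : EvalNonneg (p ^ 2) := fun x => by
  rw [eval_pow]; exact sq_nonneg _

theorem eval_nonneg_of_nonneg_ne {p : ℝ[X]} {θ : ℝ} (h : ∀ x, x ≠ θ → 0 ≤ p.eval x) :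
    EvalNonneg p := by
  have hcl : IsClosed {x | 0 ≤ p.eval x} := isClosed_le continuous_const p.continuous
  have hd : Dense ({θ}ᶜ : Set ℝ) := dense_compl_singleton θ
  intro x
  exact (hcl.closure_subset_iff.2 fun y hy => h y hy) (hd x)

theorem EvalNonneg.exists_eq_sq_mul {p : ℝ[X]} {θ : ℝ} (hp : EvalNonneg p)
    (h : p.eval θ = 0) : ∃ q, EvalNonneg q ∧ p = (X - C θ) ^ 2 * q := by
  obtain ⟨r, rfl⟩ := dvd_iff_isRoot.2 h
  have hr : r.eval θ = 0 := by
    have hcl : IsClosed {x | 0 ≤ r.eval x} := isClosed_le continuous_const r.continuous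
    have hcl' : IsClosed {x | r.eval x ≤ 0} := isClosed_le r.continuous continuous_const
    apply le_antisymm
    · have : Set.Iio θ ⊆ {x | r.eval x ≤ 0} := fun x (hx : x < θ) => by
        have := hp x
        simp only [eval_mul, eval_sub, eval_X, eval_C] at this
        by_contra! hc
        simp only [Set.mem_ofPred_eq, not_le] at hc
        nlinarith [mul_pos (sub_pos.2 hx) hc]
      have := hcl'.closure_subset_iff.2 this
      rw [closure_Iio] at this
      exact this (Set.mem_Iic.2 le_rfl)
    · have : Set.Ioi θ ⊆ {x | 0 ≤ r.eval x} := fun x (hx : θ < x) => by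
        have := hp x
        simp only [eval_mul, eval_sub, eval_X, eval_C] at this
        exact nonneg_of_mul_nonneg_right this (sub_pos.2 hx)
      have := hcl.closure_subset_iff.2 this
      rw [closure_Ioi] at this
      exact this (Set.mem_Ici.2 le_rfl)
  obtain ⟨q, rfl⟩ := dvd_iff_isRoot.2 hr
  refine ⟨q, eval_nonneg_of_nonneg_ne (θ := θ) fun x hx => ?_, by ring⟩
  have := hp x
  simp only [eval_mul, eval_sub, eval_X, eval_C] at this
  rw [← mul_assoc, ← sq] at this
  exact nonneg_of_mul_nonneg_right this (by have := sub_ne_zero.2 hx; positivity)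

theorem EvalNonneg.pow_dvd_left {θ : ℝ} (n : ℕ) {p q : ℝ[X]} (hp : EvalNonneg p)
    (hq : EvalNonneg q) (h : (X - C θ) ^ (2 * n + 1) ∣ p + q) :
    (X - C θ) ^ (2 * n + 2) ∣ p := by
  induction n generalizing p q with
  | zero =>
    have h0 : (p + q).eval θ = 0 := dvd_iff_isRoot.1 (by simpa using h)
    rw [eval_add] at h0
    obtain ⟨r, -, rfl⟩ := hp.exists_eq_sq_mul (θ := θ) (by linarith [hp θ, hq θ])
    exact dvd_mul_right _ _
  | succ n ih =>
    have h0 : (p + q).eval θ = 0 :=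
      dvd_iff_isRoot.1 ((dvd_pow_self _ (by omega)).trans h)
    rw [eval_add] at h0
    obtain ⟨r, hr, rfl⟩ := hp.exists_eq_sq_mul (θ := θ) (by linarith [hp θ, hq θ])
    obtain ⟨s, hs, rfl⟩ := hq.exists_eq_sq_mul (θ := θ) (by linarith [hp θ, hq θ])
    have ht : ((X - C θ) ^ 2 : ℝ[X]) ≠ 0 := pow_ne_zero _ (X_sub_C_ne_zero θ)
    rw [← mul_add, show 2 * (n + 1) + 1 = 2 + (2 * n + 1) by ring, pow_add,
      mul_dvd_mul_iff_left ht] at h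
    rw [show 2 * (n + 1) + 2 = 2 + (2 * n + 2) by ring, pow_add, mul_dvd_mul_iff_left ht]
    exact ih hr hs h

theorem EvalNonneg.pow_two_mul_dvd_left {θ : ℝ} (n : ℕ) {p q : ℝ[X]} (hp : EvalNonneg p)
    (hq : EvalNonneg q) (h : (X - C θ) ^ (2 * n) ∣ p + q) : (X - C θ) ^ (2 * n) ∣ p := by
  cases n with
  | zero => simp
  | succ n => exact hp.pow_dvd_left n hq ((pow_dvd_pow _ (by omega)).trans h)

theorem EvalNonneg.pow_dvd_succ {θ : ℝ} (n : ℕ) {p : ℝ[X]} (hp : EvalNonneg p)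
    (h : (X - C θ) ^ (2 * n + 1) ∣ p) : (X - C θ) ^ (2 * n + 2) ∣ p :=
  hp.pow_dvd_left n (q := 0) (fun x => by simp) (by simpa using h)

theorem EvalNonneg.pow_two_mul_dvd_of_sum {ι : Type*} {s : Finset ι} {f : ι → ℝ[X]} {θ : ℝ}
    (n : ℕ) (hf : ∀ i ∈ s, EvalNonneg (f i)) (h : (X - C θ) ^ (2 * n) ∣ ∑ i ∈ s, f i)
    {i : ι} (hi : i ∈ s) : (X - C θ) ^ (2 * n) ∣ f i := by
  classical
  rw [← Finset.add_sum_erase s f hi] at h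
  exact (hf i hi).pow_two_mul_dvd_left n
    (EvalNonneg.sum fun j hj => hf j (Finset.mem_of_mem_erase hj)) h

theorem pow_dvd_of_pow_two_mul_dvd_sq {θ : ℝ} {n : ℕ} {p : ℝ[X]}
    (h : (X - C θ) ^ (2 * n) ∣ p ^ 2) : (X - C θ) ^ n ∣ p := by
  rw [mul_comm, pow_mul] at h
  exact (IsIntegrallyClosed.pow_dvd_pow_iff two_ne_zero).1 h

end Divisibility

section SubsetPolynomial

open Classical in
/-- The matchings of `G` all of whose edges lie within `S`. -/
noncomputable def matchingsIn [Fintype V] (G : SimpleGraph V) (S : Finset V) :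
    Finset (Finset (Sym2 V)) :=
  Finset.univ.filter fun A => (A : Set (Sym2 V)) ⊆ G.edgeSet ∧
    ((A : Set (Sym2 V)).Pairwise fun e f => ∀ v : V, v ∈ e → v ∉ f) ∧
    ∀ e ∈ A, ∀ v ∈ e, v ∈ S

/-- The matching polynomial of the subgraph of `G` induced by `S`. -/
noncomputable def inducedPoly [Fintype V] (G : SimpleGraph V) (S : Finset V) : ℝ[X] :=
  ∑ A ∈ matchingsIn G S, C ((-1 : ℝ) ^ A.card) * X ^ (S.card - 2 * A.card)

open Classical in
/-- The adjacency indicator of `G`, as a constant polynomial. -/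
noncomputable def adjInd (G : SimpleGraph V) (u v : V) : ℝ[X] := if G.Adj u v then 1 else 0

variable [Fintype V] {G : SimpleGraph V}

theorem mem_matchingsIn {S : Finset V} {A : Finset (Sym2 V)} :
    A ∈ matchingsIn G S ↔ (A : Set (Sym2 V)) ⊆ G.edgeSet ∧
      ((A : Set (Sym2 V)).Pairwise fun e f => ∀ v : V, v ∈ e → v ∉ f) ∧
      ∀ e ∈ A, ∀ v ∈ e, v ∈ S := by
  simp [matchingsIn]

theorem two_mul_card_le {S : Finset V} {A : Finset (Sym2 V)} (hA : A ∈ matchingsIn G S) :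
    2 * A.card ≤ S.card := by
  classical
  obtain ⟨hE, hP, hS⟩ := mem_matchingsIn.1 hA
  have hdisj : (A : Set (Sym2 V)).PairwiseDisjoint Sym2.toFinset := by
    intro e he f hf hef
    refine Finset.disjoint_left.2 fun v hv hv' => ?_
    exact hP he hf hef v (by simpa using hv) (by simpa using hv')
  have hcard : (A.biUnion Sym2.toFinset).card = A.card * 2 := by
    rw [Finset.card_biUnion hdisj, Finset.sum_const_nat]
    intro e he
    exact Sym2.card_toFinset_of_not_isDiag e (G.not_isDiag_of_mem_edgeSet (hE he))
  have hsub : A.biUnion Sym2.toFinset ⊆ S := by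
    intro v hv
    obtain ⟨e, he, hve⟩ := Finset.mem_biUnion.1 hv
    exact hS e he v (by simpa using hve)
  have := Finset.card_le_card hsub
  omega

theorem matchingPoly_eq_inducedPoly {W : Type*} (H : SimpleGraph W) (f : W ↪ V)
    (hf : ∀ a b, G.Adj (f a) (f b) ↔ H.Adj a b) (S : Finset V)
    (hS : ∀ v, v ∈ S ↔ v ∈ Set.range f) :
    matchingPoly H = inducedPoly G S := by
  classical
  have hcard : Nat.card W = S.card := by
    rw [Nat.card_congr (Equiv.ofInjective f f.injective),
      ← show (S : Set V) = Set.range f from Set.ext hS]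
    simp
  have hnum (r : ℕ) : numMatchings H r = ((matchingsIn G S).filter fun A => A.card = r).card := by
    rw [← Nat.card_eq_finsetCard, numMatchings]
    have hmem (A : Finset (Sym2 W)) : A.map f.sym2Map ∈ matchingsIn G S ↔
        (A : Set (Sym2 W)) ⊆ H.edgeSet ∧
          (A : Set (Sym2 W)).Pairwise fun e g => ∀ v : W, v ∈ e → v ∉ g := by
      have hedge (e : Sym2 W) : e.map f ∈ G.edgeSet ↔ e ∈ H.edgeSet := by
        induction e with | _ a b => simp [hf]
      have hdisj (e g : Sym2 W) : (∀ v : V, v ∈ e.map f → v ∉ g.map f) ↔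
          ∀ v : W, v ∈ e → v ∉ g := by
        simp only [Sym2.mem_map]
        exact ⟨fun h v hv hg => h (f v) ⟨v, hv, rfl⟩ ⟨v, hg, rfl⟩, by
          rintro h _ ⟨a, ha, rfl⟩ ⟨b, hb, hab⟩
          exact h a ha (f.injective hab ▸ hb)⟩
      rw [mem_matchingsIn, Finset.coe_map,
        (f.sym2Map.injective.injOn (s := (A : Set (Sym2 W)))).pairwise_image]
      simp only [Set.image_subset_iff, Function.Embedding.sym2Map_apply]
      constructor
      · rintro ⟨h1, h2, -⟩
        refine ⟨fun e he => (hedge e).1 (h1 he), fun e he g hg hne => ?_⟩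
        exact (hdisj e g).1 (h2 he hg hne)
      · rintro ⟨h1, h2⟩
        refine ⟨fun e he => (hedge e).2 (h1 he), fun e he g hg hne => ?_, ?_⟩
        · exact (hdisj e g).2 (h2 he hg hne)
        · intro e he v hv
          obtain ⟨e, -, rfl⟩ := Finset.mem_map.1 he
          obtain ⟨a, -, rfl⟩ := Sym2.mem_map.1 hv
          exact (hS _).2 ⟨a, rfl⟩
    refine Nat.card_congr (Equiv.ofBijective
      (fun A => ⟨A.1.map f.sym2Map, Finset.mem_filter.2
        ⟨(hmem A.1).2 A.2.2, by rw [Finset.card_map, A.2.1]⟩⟩) ⟨?_, ?_⟩)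
    · intro A B hAB
      exact Subtype.ext (Finset.map_injective _ (Subtype.ext_iff.1 hAB))
    · rintro ⟨B, hB⟩
      obtain ⟨hB, hr⟩ := Finset.mem_filter.1 hB
      have hBr : (B : Set (Sym2 V)) ⊆ Set.range f.sym2Map := by
        intro e he
        have hv := (mem_matchingsIn.1 hB).2.2 e he
        induction e with | _ a b =>
        obtain ⟨a, rfl⟩ := (hS _).1 (hv a (by simp))
        obtain ⟨b, rfl⟩ := (hS _).1 (hv b (by simp))
        exact ⟨s(a, b), by simp⟩
      obtain ⟨A, rfl⟩ : ∃ A : Finset (Sym2 W), A.map f.sym2Map = B :=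
        ⟨B.preimage f.sym2Map f.sym2Map.injective.injOn, by
          rw [Finset.map_eq_image, Finset.image_preimage, Finset.filter_true_of_mem hBr]⟩
      exact ⟨⟨A, by rw [← hr, Finset.card_map], (hmem A).1 hB⟩, rfl⟩
  rw [matchingPoly, inducedPoly, hcard,
    ← Finset.sum_fiberwise_of_maps_to (g := Finset.card) (t := Finset.range (S.card + 1))]
  · refine Finset.sum_congr rfl fun r _ => ?_
    rw [Finset.sum_congr rfl (g := fun _ => C ((-1 : ℝ) ^ r) * X ^ (S.card - 2 * r)),
      Finset.sum_const, hnum, nsmul_eq_mul, C_mul, map_natCast]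
    · ring
    · intro A hA
      rw [(Finset.mem_filter.1 hA).2]
  · intro A hA
    have := two_mul_card_le hA
    simp; omega

theorem filter_matchingsIn_erase [DecidableEq V] (S : Finset V) (u : V) :
    (matchingsIn G S).filter (fun A => ∀ e ∈ A, u ∉ e) = matchingsIn G (S.erase u) := by
  ext A
  simp only [Finset.mem_filter, mem_matchingsIn, Finset.mem_erase]
  constructor
  · rintro ⟨⟨h1, h2, h3⟩, h4⟩
    exact ⟨h1, h2, fun e he v hv => ⟨fun h => h4 e he (h ▸ hv), h3 e he v hv⟩⟩
  · rintro ⟨h1, h2, h3⟩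
    exact ⟨⟨h1, h2, fun e he v hv => (h3 e he v hv).2⟩, fun e he hu => (h3 e he u hu).1 rfl⟩

theorem notMem_of_mem_matchingsIn_erase [DecidableEq V] {S T : Finset V} {u : V}
    {A : Finset (Sym2 V)} (hA : A ∈ matchingsIn G T) (hT : T ⊆ S.erase u) (w : V) :
    s(u, w) ∉ A := fun h =>
  (Finset.mem_erase.1 (hT ((mem_matchingsIn.1 hA).2.2 _ h u (by simp)))).1 rfl

theorem insert_mem_matchingsIn [DecidableEq V] {S : Finset V} {u w : V} (hu : u ∈ S)
    (hw : w ∈ S) (huw : G.Adj u w) {A : Finset (Sym2 V)}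
    (hA : A ∈ matchingsIn G ((S.erase u).erase w)) : insert s(u, w) A ∈ matchingsIn G S := by
  obtain ⟨h1, h2, h3⟩ := mem_matchingsIn.1 hA
  have hdisj : ∀ e ∈ A, ∀ v ∈ s(u, w), v ∉ e := by
    intro e he v hv hve
    have := h3 e he v hve
    rcases Sym2.mem_iff.1 hv with rfl | rfl <;> simp at this
  refine mem_matchingsIn.2 ⟨?_, ?_, ?_⟩
  · rw [Finset.coe_insert, Set.insert_subset_iff]
    exact ⟨huw, h1⟩
  · rw [Finset.coe_insert]
    refine h2.insert fun e he _ => ⟨hdisj e he, fun v hv hv' => hdisj e he v hv' hv⟩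
  · intro e he v hv
    rcases Finset.mem_insert.1 he with rfl | he
    · rcases Sym2.mem_iff.1 hv with rfl | rfl <;> assumption
    · exact Finset.mem_of_mem_erase (Finset.mem_of_mem_erase (h3 e he v hv))

theorem erase_mem_matchingsIn [DecidableEq V] {S : Finset V} {u w : V}
    {A : Finset (Sym2 V)} (hA : A ∈ matchingsIn G S) (h : s(u, w) ∈ A) :
    A.erase s(u, w) ∈ matchingsIn G ((S.erase u).erase w) := by
  obtain ⟨h1, h2, h3⟩ := mem_matchingsIn.1 hA
  have hsub : A.erase s(u, w) ⊆ A := Finset.erase_subset _ _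
  refine mem_matchingsIn.2 ⟨(Finset.coe_subset.2 hsub).trans h1,
    h2.mono (Finset.coe_subset.2 hsub), fun e he v hv => ?_⟩
  obtain ⟨hne, he⟩ := Finset.mem_erase.1 he
  have hd := h2 he h hne v hv
  simp only [Sym2.mem_iff, not_or] at hd
  exact Finset.mem_erase.2 ⟨hd.2, Finset.mem_erase.2 ⟨hd.1, h3 e he v hv⟩⟩

theorem inducedPoly_rec [DecidableEq V] {S : Finset V} {u : V} (hu : u ∈ S) :
    inducedPoly G S = X * inducedPoly G (S.erase u) -
      ∑ w ∈ S.erase u, adjInd G u w * inducedPoly G ((S.erase u).erase w) := by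
  classical
  have hcard : S.card = (S.erase u).card + 1 := (Finset.card_erase_add_one hu).symm
  have hmiss : ∑ A ∈ (matchingsIn G S).filter (fun A => ∀ e ∈ A, u ∉ e),
      C ((-1 : ℝ) ^ A.card) * X ^ (S.card - 2 * A.card) = X * inducedPoly G (S.erase u) := by
    rw [filter_matchingsIn_erase, inducedPoly, Finset.mul_sum]
    refine Finset.sum_congr rfl fun A hA => ?_
    have := two_mul_card_le hA
    rw [hcard, show (S.erase u).card + 1 - 2 * A.card = (S.erase u).card - 2 * A.card + 1 by omega]
    ring
  have hcover : ∑ A ∈ (matchingsIn G S).filter (fun A => ¬ ∀ e ∈ A, u ∉ e),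
      C ((-1 : ℝ) ^ A.card) * X ^ (S.card - 2 * A.card) =
      - ∑ w ∈ S.erase u, adjInd G u w * inducedPoly G ((S.erase u).erase w) := by
    have hfilter : ∑ w ∈ S.erase u, adjInd G u w * inducedPoly G ((S.erase u).erase w) =
        ∑ w ∈ (S.erase u).filter (G.Adj u), inducedPoly G ((S.erase u).erase w) := by
      rw [Finset.sum_filter]
      refine Finset.sum_congr rfl fun w _ => ?_
      unfold adjInd
      split_ifs <;> simp
    rw [hfilter, ← Finset.sum_neg_distrib]
    simp only [inducedPoly, ← Finset.sum_neg_distrib]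
    rw [Finset.sum_sigma']
    symm
    refine Finset.sum_bij (fun x _ => insert s(u, x.1) x.2) ?_ ?_ ?_ ?_
    · rintro ⟨w, A⟩ hx
      simp only [Finset.mem_sigma, Finset.mem_filter] at hx
      refine Finset.mem_filter.2
        ⟨insert_mem_matchingsIn hu (Finset.mem_of_mem_erase hx.1.1) hx.1.2 hx.2, fun h => ?_⟩
      exact h s(u, w) (Finset.mem_insert_self _ _) (by simp)
    · rintro ⟨w, A⟩ hx ⟨w', A'⟩ hx' heq
      simp only [Finset.mem_sigma, Finset.mem_filter] at hx hx' heq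
      have hA := notMem_of_mem_matchingsIn_erase hx.2 (Finset.erase_subset _ _)
      have hA' := notMem_of_mem_matchingsIn_erase hx'.2 (Finset.erase_subset _ _)
      have hw : s(u, w) = s(u, w') :=
        (Finset.mem_insert.1 (heq ▸ Finset.mem_insert_self s(u, w) A)).resolve_right (hA' w)
      obtain rfl : w = w' := Sym2.congr_right.1 hw
      have hAA : A = A' := by
        rw [← Finset.erase_insert (hA w), heq, Finset.erase_insert (hA' w)]
      rw [hAA]
    · intro A hA
      obtain ⟨hA, h⟩ := Finset.mem_filter.1 hA
      push Not at h
      obtain ⟨e, he, hue⟩ := h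
      obtain ⟨w, rfl⟩ := Sym2.mem_iff_exists.1 hue
      have hadj : G.Adj u w := (mem_matchingsIn.1 hA).1 he
      have hw : w ∈ S := (mem_matchingsIn.1 hA).2.2 _ he w (by simp)
      refine ⟨⟨w, A.erase s(u, w)⟩, ?_, Finset.insert_erase he⟩
      simp only [Finset.mem_sigma, Finset.mem_filter, Finset.mem_erase]
      exact ⟨⟨⟨hadj.ne', hw⟩, hadj⟩, erase_mem_matchingsIn hA he⟩
    · rintro ⟨w, A⟩ hx
      simp only [Finset.mem_sigma, Finset.mem_filter] at hx
      have hA := notMem_of_mem_matchingsIn_erase hx.2 (Finset.erase_subset _ _) w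
      have := Finset.card_erase_of_mem hx.1.1
      rw [Finset.card_insert_of_notMem hA, this, hcard,
        show (S.erase u).card - 1 - 2 * A.card = (S.erase u).card + 1 - 2 * (A.card + 1) by omega]
      simp only [pow_succ, C_mul, C_neg, map_one]
      ring
  rw [sub_eq_add_neg, ← hmiss, ← hcover, inducedPoly, Finset.sum_filter_add_sum_filter_not]

theorem inducedPoly_empty : inducedPoly G ∅ = 1 := by
  have : matchingsIn G ∅ = {∅} := by
    ext A
    rw [Finset.mem_singleton]
    constructor
    · intro hA
      have := two_mul_card_le hA
      exact Finset.card_eq_zero.1 (by simpa using this)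
    · rintro rfl
      simp [mem_matchingsIn]
  simp [inducedPoly, this]

end SubsetPolynomial

section PathIdentities

variable {G : SimpleGraph V}

theorem adjInd_of_adj {u v : V} (h : G.Adj u v) : adjInd G u v = 1 := if_pos h

theorem adjInd_of_not_adj {u v : V} (h : ¬ G.Adj u v) : adjInd G u v = 0 := if_neg h

theorem evalNonneg_adjInd (G : SimpleGraph V) (u v : V) : EvalNonneg (adjInd G u v) := by
  intro x
  unfold adjInd
  split_ifs <;> simp

variable [Fintype V] [DecidableEq V] {S : Finset V} {θ : ℝ}

theorem inducedPoly_monic_and_natDegree (G : SimpleGraph V) (S : Finset V) :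
    (inducedPoly G S).Monic ∧ (inducedPoly G S).natDegree = S.card := by
  induction S using Finset.strongInduction with
  | _ S ih =>
    obtain rfl | ⟨u, hu⟩ := S.eq_empty_or_nonempty
    · simp [inducedPoly_empty]
    obtain ⟨hm, hd⟩ := ih _ (Finset.erase_ssubset hu)
    have hXm : (X * inducedPoly G (S.erase u)).Monic := monic_X.mul hm
    have hXd : (X * inducedPoly G (S.erase u)).degree = (S.card : WithBot ℕ) := by
      rw [degree_mul, degree_X, degree_eq_natDegree hm.ne_zero, hd,
        ← Finset.card_erase_add_one hu]
      push_cast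
      ring
    have hlt : (∑ w ∈ S.erase u, adjInd G u w * inducedPoly G ((S.erase u).erase w)).degree <
        (X * inducedPoly G (S.erase u)).degree := by
      rw [hXd]
      refine (degree_sum_le _ _).trans_lt ((Finset.sup_lt_iff (WithBot.bot_lt_coe _)).2 ?_)
      intro w hw
      by_cases huw : G.Adj u w
      · have hss : (S.erase u).erase w ⊂ S :=
          (Finset.erase_ssubset hw).trans (Finset.erase_ssubset hu)
        obtain ⟨hm', hd'⟩ := ih _ hss
        rw [adjInd_of_adj huw, one_mul, degree_eq_natDegree hm'.ne_zero, hd']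
        exact_mod_cast Finset.card_lt_card hss
      · rw [adjInd_of_not_adj huw, zero_mul, degree_zero]
        exact WithBot.bot_lt_coe _
    rw [inducedPoly_rec hu]
    refine ⟨hXm.sub_of_left hlt, natDegree_eq_of_degree_eq_some ?_⟩
    rw [degree_sub_eq_left_of_degree_lt hlt, hXd]

theorem inducedPoly_ne_zero (G : SimpleGraph V) (S : Finset V) : inducedPoly G S ≠ 0 :=
  (inducedPoly_monic_and_natDegree G S).1.ne_zero

theorem derivative_inducedPoly (G : SimpleGraph V) (S : Finset V) :
    derivative (inducedPoly G S) = ∑ v ∈ S, inducedPoly G (S.erase v) := by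
  induction S using Finset.strongInduction with
  | _ S ih =>
    obtain rfl | ⟨u, hu⟩ := S.eq_empty_or_nonempty
    · simp [inducedPoly_empty]
    have hE (w : V) : derivative (adjInd G u w) = 0 := by
      unfold adjInd
      split_ifs <;> simp
    rw [← Finset.add_sum_erase S _ hu]
    have hv : ∀ v ∈ S.erase u, inducedPoly G (S.erase v) =
        X * inducedPoly G ((S.erase u).erase v) -
          ∑ w ∈ (S.erase u).erase v,
            adjInd G u w * inducedPoly G (((S.erase u).erase w).erase v) := by
      intro v hv
      have hu' : u ∈ S.erase v := Finset.mem_erase.2 ⟨(Finset.ne_of_mem_erase hv).symm, hu⟩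
      rw [inducedPoly_rec hu', Finset.erase_right_comm (a := v) (b := u)]
      refine congrArg₂ _ rfl ?_
      refine Finset.sum_congr rfl fun w _ => ?_
      rw [Finset.erase_right_comm (a := v) (b := w)]
    have hswap : ∑ w ∈ S.erase u, adjInd G u w * derivative (inducedPoly G ((S.erase u).erase w)) =
        ∑ v ∈ S.erase u, ∑ w ∈ (S.erase u).erase v,
          adjInd G u w * inducedPoly G (((S.erase u).erase w).erase v) := by
      rw [Finset.sum_comm' (t' := S.erase u) (s' := fun w => (S.erase u).erase w)]
      · refine Finset.sum_congr rfl fun w hw => ?_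
        rw [ih _ ((Finset.erase_ssubset hw).trans (Finset.erase_ssubset hu)), Finset.mul_sum]
      · intro v w
        simp only [Finset.mem_erase]
        tauto
    rw [Finset.sum_congr rfl hv, Finset.sum_sub_distrib, ← hswap, ← Finset.mul_sum,
      ← ih _ (Finset.erase_ssubset hu), inducedPoly_rec hu]
    simp only [derivative_sub, derivative_mul, derivative_X, derivative_sum, hE, zero_mul, zero_add,
      one_mul]
    ring

/-- `μ(G\u) μ(G\v) - μ(G) μ(G\uv)` for the subgraph induced by `S`: a sum of squares indexed by
the paths from `u` to `v`. -/
noncomputable def pathSum (G : SimpleGraph V) (S : Finset V) (u v : V) : ℝ[X] :=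
  inducedPoly G (S.erase u) * inducedPoly G (S.erase v) -
    inducedPoly G S * inducedPoly G ((S.erase u).erase v)

/-- `μ(G\uw) μ(G\v) - μ(G) μ(G\vuw)` for the subgraph induced by `S`: a sum indexed by the paths
from `v` to `u` avoiding `w` and those from `v` to `w` avoiding `u`. -/
noncomputable def crossSum (G : SimpleGraph V) (S : Finset V) (v u w : V) : ℝ[X] :=
  inducedPoly G ((S.erase u).erase w) * inducedPoly G (S.erase v) -
    inducedPoly G S * inducedPoly G (((S.erase v).erase u).erase w)

theorem pathSum_comm (G : SimpleGraph V) (S : Finset V) (u v : V) :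
    pathSum G S u v = pathSum G S v u := by
  rw [pathSum, pathSum, Finset.erase_right_comm (a := u), mul_comm (inducedPoly G (S.erase u))]

theorem pathSum_rec {u v : V} (hu : u ∈ S) (hv : v ∈ S) (huv : u ≠ v) :
    pathSum G S u v = adjInd G u v * inducedPoly G ((S.erase u).erase v) ^ 2 +
      ∑ w ∈ (S.erase u).erase v, adjInd G u w * pathSum G (S.erase u) w v := by
  have hv' : v ∈ S.erase u := Finset.mem_erase.2 ⟨huv.symm, hv⟩
  have hu' : u ∈ S.erase v := Finset.mem_erase.2 ⟨huv, hu⟩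
  have hsum : ∑ w ∈ (S.erase u).erase v, adjInd G u w * pathSum G (S.erase u) w v =
      inducedPoly G ((S.erase u).erase v) *
          ∑ w ∈ (S.erase u).erase v, adjInd G u w * inducedPoly G ((S.erase u).erase w) -
        inducedPoly G (S.erase u) * ∑ w ∈ (S.erase u).erase v,
          adjInd G u w * inducedPoly G (((S.erase u).erase v).erase w) := by
    rw [Finset.mul_sum, Finset.mul_sum, ← Finset.sum_sub_distrib]
    refine Finset.sum_congr rfl fun w _ => ?_
    rw [pathSum, Finset.erase_right_comm (a := w) (b := v)]
    ring
  rw [hsum, pathSum, inducedPoly_rec hu, inducedPoly_rec hu', ← Finset.add_sum_erase _ _ hv',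
    Finset.erase_right_comm (a := v) (b := u)]
  ring

theorem crossSum_rec {v u w : V} (hv : v ∈ S) (hu : u ∈ S) (hw : w ∈ S) (hvu : v ≠ u)
    (hvw : v ≠ w) (huw : u ≠ w) :
    crossSum G S v u w =
      adjInd G v u * (inducedPoly G ((S.erase v).erase u) *
        inducedPoly G (((S.erase v).erase u).erase w)) +
      adjInd G v w * (inducedPoly G ((S.erase v).erase w) *
        inducedPoly G (((S.erase v).erase u).erase w)) +
      ∑ y ∈ ((S.erase v).erase u).erase w, adjInd G v y * crossSum G (S.erase v) y u w := by
  have hu' : u ∈ S.erase v := Finset.mem_erase.2 ⟨hvu.symm, hu⟩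
  have hw' : w ∈ (S.erase v).erase u :=
    Finset.mem_erase.2 ⟨huw.symm, Finset.mem_erase.2 ⟨hvw.symm, hw⟩⟩
  have hv' : v ∈ (S.erase u).erase w :=
    Finset.mem_erase.2 ⟨hvw, Finset.mem_erase.2 ⟨hvu, hv⟩⟩
  have hcomm : ((S.erase u).erase w).erase v = ((S.erase v).erase u).erase w := by
    rw [Finset.erase_right_comm (a := w) (b := v), Finset.erase_right_comm (a := u) (b := v)]
  have hsum : ∑ y ∈ ((S.erase v).erase u).erase w, adjInd G v y * crossSum G (S.erase v) y u w =
      inducedPoly G (((S.erase v).erase u).erase w) *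
          ∑ y ∈ ((S.erase v).erase u).erase w, adjInd G v y * inducedPoly G ((S.erase v).erase y) -
        inducedPoly G (S.erase v) * ∑ y ∈ ((S.erase v).erase u).erase w,
          adjInd G v y * inducedPoly G ((((S.erase v).erase u).erase w).erase y) := by
    rw [Finset.mul_sum, Finset.mul_sum, ← Finset.sum_sub_distrib]
    refine Finset.sum_congr rfl fun y _ => ?_
    rw [crossSum, Finset.erase_right_comm (a := w) (b := y),
      Finset.erase_right_comm (a := u) (b := y)]
    ring
  rw [hsum, crossSum, inducedPoly_rec hv, inducedPoly_rec hv', ← Finset.add_sum_erase _ _ hu',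
    ← Finset.add_sum_erase _ _ hw', hcomm]
  ring

theorem evalNonneg_pathSum {u v : V} (hu : u ∈ S) (hv : v ∈ S) (huv : u ≠ v) :
    EvalNonneg (pathSum G S u v) := by
  induction S using Finset.strongInduction generalizing u v with
  | _ S ih =>
    rw [pathSum_rec hu hv huv]
    refine ((evalNonneg_adjInd G u v).mul (evalNonneg_sq _)).add (EvalNonneg.sum fun w hw => ?_)
    obtain ⟨hwv, hw⟩ := Finset.mem_erase.1 hw
    exact (evalNonneg_adjInd G u w).mul
      (ih _ (Finset.erase_ssubset hu) hw (Finset.mem_erase.2 ⟨huv.symm, hv⟩) hwv)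

theorem pow_dvd_of_pow_dvd_pathSum {n : ℕ} {u v : V} (hu : u ∈ S) (hv : v ∈ S) (huv : u ≠ v)
    (h : (X - C θ) ^ (2 * n) ∣ pathSum G S u v) :
    (G.Adj u v → (X - C θ) ^ n ∣ inducedPoly G ((S.erase u).erase v)) ∧
      ∀ w ∈ (S.erase u).erase v, G.Adj u w →
        (X - C θ) ^ (2 * n) ∣ pathSum G (S.erase u) w v := by
  have hnn : EvalNonneg (adjInd G u v * inducedPoly G ((S.erase u).erase v) ^ 2) :=
    (evalNonneg_adjInd G u v).mul (evalNonneg_sq _)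
  have hnn' : ∀ w ∈ (S.erase u).erase v,
      EvalNonneg (adjInd G u w * pathSum G (S.erase u) w v) := fun w hw => by
    obtain ⟨hwv, hw⟩ := Finset.mem_erase.1 hw
    exact (evalNonneg_adjInd G u w).mul
      (evalNonneg_pathSum hw (Finset.mem_erase.2 ⟨huv.symm, hv⟩) hwv)
  rw [pathSum_rec hu hv huv] at h
  constructor
  · intro hadj
    have := hnn.pow_two_mul_dvd_left n (EvalNonneg.sum hnn') h
    rw [adjInd_of_adj hadj, one_mul] at this
    exact pow_dvd_of_pow_two_mul_dvd_sq this
  · intro w hw hadj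
    rw [add_comm] at h
    have := EvalNonneg.pow_two_mul_dvd_of_sum n hnn'
      ((EvalNonneg.sum hnn').pow_two_mul_dvd_left n hnn h) hw
    rwa [adjInd_of_adj hadj, one_mul] at this

theorem pow_dvd_crossSum {i j : ℕ} {v u w : V} (hv : v ∈ S) (hu : u ∈ S) (hw : w ∈ S)
    (hvu : v ≠ u) (hvw : v ≠ w) (huw : u ≠ w)
    (h1 : (X - C θ) ^ (2 * i) ∣ pathSum G S v u)
    (h2 : (X - C θ) ^ (2 * j) ∣ pathSum G (S.erase w) v u)
    (h3 : (X - C θ) ^ (2 * i) ∣ pathSum G S v w)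
    (h4 : (X - C θ) ^ (2 * j) ∣ pathSum G (S.erase u) v w) :
    (X - C θ) ^ (i + j) ∣ crossSum G S v u w := by
  induction S using Finset.strongInduction generalizing v with
  | _ S ih =>
    obtain ⟨h1a, h1b⟩ := pow_dvd_of_pow_dvd_pathSum hv hu hvu h1
    obtain ⟨h2a, h2b⟩ := pow_dvd_of_pow_dvd_pathSum (Finset.mem_erase.2 ⟨hvw, hv⟩)
      (Finset.mem_erase.2 ⟨huw, hu⟩) hvu h2
    obtain ⟨h3a, h3b⟩ := pow_dvd_of_pow_dvd_pathSum hv hw hvw h3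
    obtain ⟨h4a, h4b⟩ := pow_dvd_of_pow_dvd_pathSum (Finset.mem_erase.2 ⟨hvu, hv⟩)
      (Finset.mem_erase.2 ⟨huw.symm, hw⟩) hvw h4
    have hcw : ((S.erase w).erase v).erase u = ((S.erase v).erase u).erase w := by
      rw [Finset.erase_right_comm (a := w) (b := v), Finset.erase_right_comm (a := w) (b := u)]
    have hcu : ((S.erase u).erase v).erase w = ((S.erase v).erase u).erase w := by
      rw [Finset.erase_right_comm (a := u) (b := v)]
    rw [hcw] at h2a h2b
    rw [hcu] at h4a h4b
    rw [Finset.erase_right_comm (a := w) (b := v)] at h2b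
    rw [Finset.erase_right_comm (a := u) (b := v)] at h4b
    rw [crossSum_rec hv hu hw hvu hvw huw]
    refine dvd_add (dvd_add ?_ ?_) (Finset.dvd_sum fun y hy => ?_)
    · by_cases hadj : G.Adj v u
      · rw [adjInd_of_adj hadj, one_mul, pow_add]
        exact mul_dvd_mul (h1a hadj) (h2a hadj)
      · simp [adjInd_of_not_adj hadj]
    · by_cases hadj : G.Adj v w
      · rw [adjInd_of_adj hadj, one_mul, pow_add]
        exact mul_dvd_mul (h3a hadj) (h4a hadj)
      · simp [adjInd_of_not_adj hadj]
    · by_cases hadj : G.Adj v y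
      · rw [adjInd_of_adj hadj, one_mul]
        have hy' := hy
        simp only [Finset.mem_erase] at hy'
        obtain ⟨hyw, hyu, hyv, hyS⟩ := hy'
        exact ih _ (Finset.erase_ssubset hv) (by simp [*]) (by simp [*, hvu.symm])
          (by simp [*, hvw.symm]) hyu hyw
          (h1b y (by simp [*]) hadj) (h2b y hy hadj) (h3b y (by simp [*]) hadj) (h4b y hy hadj)
      · simp [adjInd_of_not_adj hadj]

end PathIdentities

section Gallai

variable [Fintype V] [DecidableEq V] {G : SimpleGraph V} {S : Finset V} {θ : ℝ}

theorem sum_pathSum {u : V} (hu : u ∈ S) :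
    inducedPoly G (S.erase u) ^ 2 + ∑ v ∈ S.erase u, pathSum G S u v =
      derivative (inducedPoly G S) * inducedPoly G (S.erase u) -
        inducedPoly G S * derivative (inducedPoly G (S.erase u)) := by
  rw [derivative_inducedPoly, derivative_inducedPoly, ← Finset.add_sum_erase _ _ hu, add_mul,
    Finset.sum_mul, Finset.mul_sum, add_sub_assoc, ← Finset.sum_sub_distrib, sq]
  refine congrArg₂ _ rfl ?_
  refine Finset.sum_congr rfl fun v _ => ?_
  rw [pathSum, mul_comm (inducedPoly G (S.erase u))]

theorem pow_dvd_inducedPoly_erase {k : ℕ} {u : V} (hu : u ∈ S)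
    (h : (X - C θ) ^ (k + 1) ∣ inducedPoly G S) :
    (X - C θ) ^ k ∣ inducedPoly G (S.erase u) := by
  suffices ∀ j ≤ k, (X - C θ) ^ j ∣ inducedPoly G (S.erase u) from this k le_rfl
  intro j
  induction j with
  | zero => simp
  | succ j ih =>
    intro hj
    have hdvd := ih (by omega)
    have hW : (X - C θ) ^ (2 * j + 1) ∣
        inducedPoly G (S.erase u) ^ 2 + ∑ v ∈ S.erase u, pathSum G S u v := by
      rw [sum_pathSum hu]
      refine dvd_sub ?_ ?_
      · refine (pow_dvd_pow _ (show 2 * j + 1 ≤ (k + 1 - 1) + j by omega)).trans ?_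
        rw [pow_add]
        exact mul_dvd_mul (pow_sub_one_dvd_derivative_of_pow_dvd h) hdvd
      · refine (pow_dvd_pow _ (show 2 * j + 1 ≤ (k + 1) + (j - 1) by omega)).trans ?_
        rw [pow_add]
        exact mul_dvd_mul h (pow_sub_one_dvd_derivative_of_pow_dvd hdvd)
    have := (evalNonneg_sq _).pow_dvd_left j (EvalNonneg.sum fun v hv =>
      evalNonneg_pathSum hu (Finset.mem_of_mem_erase hv) (Finset.ne_of_mem_erase hv).symm) hW
    exact pow_dvd_of_pow_two_mul_dvd_sq this

theorem pow_dvd_inducedPoly_of_erase {k : ℕ} {u : V} (hu : u ∈ S)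
    (h : (X - C θ) ^ (k + 1) ∣ inducedPoly G (S.erase u)) :
    (X - C θ) ^ k ∣ inducedPoly G S := by
  rw [inducedPoly_rec hu]
  refine dvd_sub (((pow_dvd_pow _ k.le_succ).trans h).mul_left _) (Finset.dvd_sum fun w hw => ?_)
  exact (pow_dvd_inducedPoly_erase hw h).mul_left _

/-- If `u`, `v` are distinct vertices of `S` whose deletion lowers the multiplicity of `θ`, then
`θ` is a root of high multiplicity of the path sum from `u` to `v`. -/
theorem pow_dvd_pathSum {j : ℕ} {u v : V} (hu : u ∈ S) (hv : v ∈ S) (huv : u ≠ v)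
    (h : (X - C θ) ^ (j + 2) ∣ inducedPoly G S) :
    (X - C θ) ^ (2 * (j + 1)) ∣ pathSum G S u v := by
  have hdu := pow_dvd_inducedPoly_erase hu h
  have hdv := pow_dvd_inducedPoly_erase hv h
  have hduv := pow_dvd_inducedPoly_erase (Finset.mem_erase.2 ⟨huv.symm, hv⟩) hdu
  refine dvd_sub ?_ ?_
  · rw [two_mul, pow_add]
    exact mul_dvd_mul hdu hdv
  · rw [show 2 * (j + 1) = j + 2 + j by ring, pow_add]
    exact mul_dvd_mul h hduv

theorem pow_dvd_erase_erase_of_adj {j : ℕ} {u v : V} (hu : u ∈ S) (hv : v ∈ S)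
    (huv : G.Adj u v) (h : (X - C θ) ^ (j + 2) ∣ inducedPoly G S) :
    (X - C θ) ^ (j + 1) ∣ inducedPoly G ((S.erase u).erase v) :=
  (pow_dvd_of_pow_dvd_pathSum hu hv huv.ne (pow_dvd_pathSum hu hv huv.ne h)).1 huv

theorem pow_dvd_erase_erase_trans {j : ℕ} {u v w : V} (hu : u ∈ S) (hv : v ∈ S) (hw : w ∈ S)
    (huv : u ≠ v) (hvw : v ≠ w) (huw : u ≠ w)
    (h : (X - C θ) ^ (j + 2) ∣ inducedPoly G S)
    (hess : ¬ (X - C θ) ^ (j + 2) ∣ inducedPoly G (S.erase v))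
    (h1 : (X - C θ) ^ (j + 1) ∣ inducedPoly G ((S.erase u).erase v))
    (h2 : (X - C θ) ^ (j + 1) ∣ inducedPoly G ((S.erase v).erase w)) :
    (X - C θ) ^ (j + 1) ∣ inducedPoly G ((S.erase u).erase w) := by
  by_contra hcon
  have hdu := pow_dvd_inducedPoly_erase hu h
  have hdw := pow_dvd_inducedPoly_erase hw h
  have hduw := pow_dvd_inducedPoly_erase (Finset.mem_erase.2 ⟨huw.symm, hw⟩) hdu
  have hw' : w ∈ (S.erase u).erase v :=
    Finset.mem_erase.2 ⟨hvw.symm, Finset.mem_erase.2 ⟨huw.symm, hw⟩⟩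
  have hdvuw := pow_dvd_inducedPoly_erase hw' h1
  have hu' : u ∈ S.erase w := Finset.mem_erase.2 ⟨huw, hu⟩
  have hv' : v ∈ S.erase w := Finset.mem_erase.2 ⟨hvw, hv⟩
  have hv'' : v ∈ S.erase u := Finset.mem_erase.2 ⟨huv.symm, hv⟩
  have hw'' : w ∈ S.erase u := Finset.mem_erase.2 ⟨huw.symm, hw⟩
  have key1 : (X - C θ) ^ (2 * (j + 1)) ∣ pathSum G (S.erase w) v u := by
    refine (evalNonneg_pathSum hv' hu' huv.symm).pow_dvd_succ j (dvd_sub ?_ ?_)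
    · rw [show 2 * j + 1 = (j + 1) + j by ring, pow_add]
      refine mul_dvd_mul ?_ ?_
      · rwa [Finset.erase_right_comm]
      · rwa [Finset.erase_right_comm]
    · rw [show 2 * j + 1 = (j + 1) + j by ring, pow_add]
      refine mul_dvd_mul hdw ?_
      rwa [Finset.erase_right_comm (a := w) (b := v), Finset.erase_right_comm (a := w) (b := u),
        Finset.erase_right_comm (a := v) (b := u)]
  have key2 : (X - C θ) ^ (2 * (j + 1)) ∣ pathSum G (S.erase u) v w := by
    refine (evalNonneg_pathSum hv'' hw'' hvw).pow_dvd_succ j (dvd_sub ?_ ?_)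
    · rw [show 2 * j + 1 = (j + 1) + j by ring, pow_add]
      exact mul_dvd_mul h1 hduw
    · rw [show 2 * j + 1 = (j + 1) + j by ring, pow_add]
      exact mul_dvd_mul hdu hdvuw
  have hcross := pow_dvd_crossSum hv hu hw huv.symm hvw huw (pow_dvd_pathSum hv hu huv.symm h) key1
    (pow_dvd_pathSum hv hw hvw h) key2
  have hsecond : (X - C θ) ^ (j + 1 + (j + 1)) ∣
      inducedPoly G S * inducedPoly G (((S.erase v).erase u).erase w) := by
    rw [show j + 1 + (j + 1) = j + 2 + j by ring, pow_add]
    refine mul_dvd_mul h ?_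
    rwa [Finset.erase_right_comm (a := v) (b := u)]
  have hprod := dvd_add hcross hsecond
  rw [crossSum, sub_add_cancel,
    ← le_rootMultiplicity_iff (mul_ne_zero (inducedPoly_ne_zero _ _) (inducedPoly_ne_zero _ _)),
    rootMultiplicity_mul (mul_ne_zero (inducedPoly_ne_zero _ _) (inducedPoly_ne_zero _ _))] at hprod
  rw [← le_rootMultiplicity_iff (inducedPoly_ne_zero _ _)] at hcon hess
  omega

/-- The Gallai lemma for `θ`: in a connected graph, if deleting any vertex lowers the multiplicity
of `θ`, then `θ` is at most a simple root of the matching polynomial. -/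
theorem not_pow_dvd_of_connected (hconn : G.Connected) {j : ℕ}
    (h : (X - C θ) ^ (j + 2) ∣ inducedPoly G Finset.univ)
    (hess : ∀ v, ¬ (X - C θ) ^ (j + 2) ∣ inducedPoly G (Finset.univ.erase v)) : False := by
  have hrel (u v : V) : u = v ∨
      (X - C θ) ^ (j + 1) ∣ inducedPoly G ((Finset.univ.erase u).erase v) := by
    have hreach := hconn.preconnected u v
    rw [SimpleGraph.reachable_iff_reflTransGen] at hreach
    induction hreach with
    | refl => exact Or.inl rfl
    | @tail v w _ hvw ih =>
      have hdvw := pow_dvd_erase_erase_of_adj (Finset.mem_univ v) (Finset.mem_univ w) hvw h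
      by_cases huw : u = w
      · exact Or.inl huw
      by_cases huv : u = v
      · exact Or.inr (huv ▸ hdvw)
      exact Or.inr (pow_dvd_erase_erase_trans (Finset.mem_univ u) (Finset.mem_univ v)
        (Finset.mem_univ w) huv hvw.ne huw h (hess v) (ih.resolve_left huv) hdvw)
  obtain ⟨u⟩ := hconn.nonempty
  have hder : (X - C θ) ^ (j + 1) ∣ derivative (inducedPoly G (Finset.univ.erase u)) := by
    rw [derivative_inducedPoly]
    exact Finset.dvd_sum fun v hv => (hrel u v).resolve_left (Finset.ne_of_mem_erase hv).symm
  have hdu := pow_dvd_inducedPoly_erase (Finset.mem_univ u) h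
  have hne := inducedPoly_ne_zero G (Finset.univ.erase u)
  have hle := (le_rootMultiplicity_iff hne).2 hdu
  have hroot : (inducedPoly G (Finset.univ.erase u)).IsRoot θ :=
    dvd_iff_isRoot.1 ((dvd_pow_self _ j.succ_ne_zero).trans hdu)
  have hmult := derivative_rootMultiplicity_of_root hroot
  have hdne : derivative (inducedPoly G (Finset.univ.erase u)) ≠ 0 := by
    intro h0
    rw [eq_C_of_derivative_eq_zero h0] at hroot
    rw [eq_C_of_derivative_eq_zero h0] at hne
    simp only [IsRoot.def, eval_C] at hroot
    rw [hroot, C_0] at hne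
    exact hne rfl
  rw [← le_rootMultiplicity_iff hdne, hmult] at hder
  have := hess u
  rw [← le_rootMultiplicity_iff hne] at this
  omega

end Gallai

theorem matchingPoly_eq [Fintype V] (G : SimpleGraph V) :
    matchingPoly G = inducedPoly G Finset.univ :=
  matchingPoly_eq_inducedPoly G (Function.Embedding.refl V) (fun _ _ => Iff.rfl) _ (by simp)

theorem matchingPoly_deleteVert [Fintype V] [DecidableEq V] (G : SimpleGraph V) (φ : G ≃g G)
    (v : V) : matchingPoly (deleteVert G v) = inducedPoly G (Finset.univ.erase (φ v)) := by
  refine matchingPoly_eq_inducedPoly _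
    ((Function.Embedding.subtype _).trans φ.toEquiv.toEmbedding) (fun a b => ?_) _ fun w => ?_
  · exact φ.map_adj_iff
  · rw [Finset.mem_erase]
    constructor
    · rintro ⟨hw, -⟩
      exact ⟨⟨φ.symm w, fun h => hw (by rw [← Set.mem_singleton_iff.1 h]; simp)⟩, by simp⟩
    · rintro ⟨⟨a, ha⟩, rfl⟩
      exact ⟨fun h => ha (φ.injective h), Finset.mem_univ _⟩

/-- A connected vertex-transitive graph is θ-super positive for any root θ of μ(G\z, x). -/
theorem stmt_3 {V : Type*} [Fintype V] (G : SimpleGraph V) (hconn : G.Connected)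
    (htrans : ∀ u w : V, ∃ φ : G ≃g G, φ u = w) (z : V) (θ : ℝ)
    (hroot : (matchingPoly (deleteVert G z)).IsRoot θ) :
    IsSuperPositive θ G := by
  classical
  have hdel (v : V) : matchingPoly (deleteVert G v) = inducedPoly G (Finset.univ.erase v) :=
    matchingPoly_deleteVert G (SimpleGraph.Iso.refl) v
  have hiso (v : V) : inducedPoly G (Finset.univ.erase v) =
      inducedPoly G (Finset.univ.erase z) := by
    obtain ⟨φ, rfl⟩ := htrans z v
    rw [← matchingPoly_deleteVert G φ z, hdel]
  have hne := inducedPoly_ne_zero G (Finset.univ : Finset V)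
  have hnez := inducedPoly_ne_zero G (Finset.univ.erase z)
  rw [hdel] at hroot
  have hpos : 0 < (inducedPoly G (Finset.univ.erase z)).rootMultiplicity θ :=
    (rootMultiplicity_pos hnez).2 hroot
  have hder : derivative (inducedPoly G Finset.univ) =
      C (Fintype.card V : ℝ) * inducedPoly G (Finset.univ.erase z) := by
    rw [derivative_inducedPoly, Finset.sum_congr rfl fun v _ => hiso v]
    simp
  have hcardne : (Fintype.card V : ℝ) ≠ 0 := by
    have : Nonempty V := ⟨z⟩
    exact_mod_cast Fintype.card_ne_zero
  have hmult : (derivative (inducedPoly G Finset.univ)).rootMultiplicity θ =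
      (inducedPoly G (Finset.univ.erase z)).rootMultiplicity θ := by
    rw [hder, rootMultiplicity_mul (mul_ne_zero (C_ne_zero.2 hcardne) hnez), rootMultiplicity_C,
      zero_add]
  have hzero : (inducedPoly G Finset.univ).rootMultiplicity θ = 0 := by
    by_contra hk
    have hr : (inducedPoly G Finset.univ).IsRoot θ :=
      (rootMultiplicity_pos hne).1 (Nat.pos_of_ne_zero hk)
    have := derivative_rootMultiplicity_of_root hr
    rw [hmult] at this
    obtain ⟨j, hj⟩ : ∃ j, (inducedPoly G Finset.univ).rootMultiplicity θ = j + 2 :=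
      ⟨_, (Nat.sub_add_cancel (by omega)).symm⟩
    refine not_pow_dvd_of_connected (θ := θ) (j := j) hconn
      ((le_rootMultiplicity_iff hne).1 hj.ge) fun v hv => ?_
    rw [hiso, ← le_rootMultiplicity_iff hnez] at hv
    omega
  refine ⟨by rw [mult, matchingPoly_eq, hzero], fun v => ?_⟩
  rw [mult, hdel, hiso]
  by_contra hv
  have hdvd : (X - C θ) ^ (1 + 1) ∣ inducedPoly G (Finset.univ.erase z) :=
    (le_rootMultiplicity_iff hnez).1 (by omega)
  have := (le_rootMultiplicity_iff hne).2
    (pow_dvd_inducedPoly_of_erase (Finset.mem_univ z) hdvd)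
  omega

end MatchPoly
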